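/- Let C be an m×n Cauchon diagram and let I ⊆ [m], J ⊆ [n] with |I| = |J| = k. If P = {P_1,…,P_k} is an (R_I,C_J)-path system in the Cauchon graph G_C that is NOT vertex-disjoint, then there exists an index ℓ with 1 ≤ ℓ ≤ k−1 such that the consecutive paths P_ℓ and P_{ℓ+1} share a vertex. -/

import Mathlib

universe u

/-- Quantum affine space data: a central unit `q` and units `t i j`
satisfying the quantum affine space commutation relations. -/
structure QMData (R : Type u) [Ring R] (m n : ℕ) where
  q : Rˣ
  t : Fin m → Fin n → Rˣ
  q_central : ∀ r : R, (q : R) * r = r * (q : R)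
  row_rel : ∀ (i : Fin m) ⦃j j' : Fin n⦄, j < j' →
    (t i j : R) * (t i j' : R) = (q : R) * ((t i j' : R) * (t i j : R))
  col_rel : ∀ ⦃i i' : Fin m⦄ (j : Fin n), i < i' →
    (t i j : R) * (t i' j : R) = (q : R) * ((t i' j : R) * (t i j : R))
  mixed_rel : ∀ ⦃i i' : Fin m⦄ ⦃j j' : Fin n⦄, i < i' → j ≠ j' →
    (t i j : R) * (t i' j' : R) = (t i' j' : R) * (t i j : R)

/-- `white i j = true` means the square `(i,j)` is white.  The Cauchon
condition: for every black square, either every square above it or every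
square to its left is also black. -/
def IsCauchon {m n : ℕ} (white : Fin m → Fin n → Bool) : Prop :=
  ∀ i j, white i j = false →
    (∀ i' : Fin m, i' < i → white i' j = false) ∨
    (∀ j' : Fin n, j' < j → white i j' = false)

/-- Vertices of the Cauchon graph: white squares, row vertices `r_i`,
column vertices `c_j`. -/
inductive CVertex (m n : ℕ) where
  | sq : Fin m → Fin n → CVertex m n
  | row : Fin m → CVertex m n
  | col : Fin n → CVertex m n
deriving DecidableEq

/-- Directed edges of the Cauchon graph. -/
inductive CEdge {m n : ℕ} (white : Fin m → Fin n → Bool) :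
    CVertex m n → CVertex m n → Prop where
  | fromRow (i : Fin m) (k : Fin n) :
      white i k = true → (∀ k' : Fin n, k < k' → white i k' = false) →
      CEdge white (.row i) (.sq i k)
  | toCol (i : Fin m) (j : Fin n) :
      white i j = true → (∀ i' : Fin m, i < i' → white i' j = false) →
      CEdge white (.sq i j) (.col j)
  | horiz (i : Fin m) (k j : Fin n) :
      j < k → white i k = true → white i j = true →
      (∀ j' : Fin n, j < j' → j' < k → white i j' = false) →
      CEdge white (.sq i k) (.sq i j)
  | vert (i i' : Fin m) (j : Fin n) :
      i < i' → white i j = true → white i' j = true →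
      (∀ l : Fin m, i < l → l < i' → white l j = false) →
      CEdge white (.sq i j) (.sq i' j)

/-- The weight of an edge of the Cauchon graph (1 on non-edges). -/
def wt {R : Type u} {m n : ℕ} [Ring R] (D : QMData R m n) :
    CVertex m n → CVertex m n → R
  | .row i, .sq i' k => if i = i' then (D.t i' k : R) else 1
  | .sq i k, .sq i' j =>
      if i = i' ∧ j < k then (↑((D.t i k)⁻¹) * ↑(D.t i j) : R) else 1
  | _, _ => 1

/-- A pair of vertices spans a horizontal edge (edges from `r_i` are
horizontal; edges between squares are horizontal iff the rows agree). -/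
def Horiz {m n : ℕ} : CVertex m n → CVertex m n → Prop
  | .row _, _ => True
  | .sq i _, .sq i' _ => i = i'
  | _, _ => False

/-- `l` is (the list of vertices of) a directed path from `u` to `v`. -/
def IsPathFrom {m n : ℕ} (white : Fin m → Fin n → Bool) (u v : CVertex m n)
    (l : List (CVertex m n)) : Prop :=
  l.Chain' (CEdge white) ∧ l.head? = some u ∧ l.getLast? = some v

/-- The list of (endpoint pairs of the) edges of a path. -/
def steps {m n : ℕ} (l : List (CVertex m n)) : List (CVertex m n × CVertex m n) :=
  l.zip l.tail

/-- The weight of a path: the ordered product of its edge weights. -/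
def pathWeight {R : Type u} {m n : ℕ} [Ring R] (D : QMData R m n)
    (l : List (CVertex m n)) : R :=
  ((steps l).map fun p => wt D p.1 p.2).prod

/-- The number of inversions (length) of a permutation of `Fin k`. -/
def invCount {k : ℕ} (σ : Equiv.Perm (Fin k)) : ℕ :=
  ((Finset.univ : Finset (Fin k × Fin k)).filter fun p => p.1 < p.2 ∧ σ p.2 < σ p.1).card

/-- The quantum determinant of a `k × k` matrix over a (noncommutative) ring. -/
def qdet {R : Type u} [Ring R] {k : ℕ} (q : Rˣ) (N : Matrix (Fin k) (Fin k) R) : R :=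
  ∑ σ : Equiv.Perm (Fin k),
    (-(q : R)) ^ invCount σ * ((List.finRange k).map fun i => N i (σ i)).prod

/-- The path matrix: entry `(i,j)` is the sum of the weights of all directed
paths from `r_i` to `c_j` (zero when there are none). -/
noncomputable def pathMatrix {R : Type u} {m n : ℕ} [Ring R] (D : QMData R m n)
    (white : Fin m → Fin n → Bool) : Matrix (Fin m) (Fin n) R :=
  Matrix.of fun i j =>
    ∑ᶠ p : {l : List (CVertex m n) // IsPathFrom white (.row i) (.col j) l},
      pathWeight D p.1

/-- An `(R_I, C_J)`-path system: paths `P ℓ : r_{i_ℓ} ⇒ c_{j_{σ ℓ}}`. -/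
structure PathSys {m n : ℕ} (white : Fin m → Fin n → Bool) {k : ℕ}
    (ι : Fin k → Fin m) (κ : Fin k → Fin n) where
  σ : Equiv.Perm (Fin k)
  P : Fin k → List (CVertex m n)
  isPath : ∀ l : Fin k, IsPathFrom white (.row (ι l)) (.col (κ (σ l))) (P l)

/-- A path system is vertex-disjoint if no two of its paths share a vertex. -/
def PathSys.VertexDisjoint {m n : ℕ} {white : Fin m → Fin n → Bool} {k : ℕ}
    {ι : Fin k → Fin m} {κ : Fin k → Fin n} (S : PathSys white ι κ) : Prop :=
  ∀ a b : Fin k, a ≠ b → ∀ x : CVertex m n, x ∈ S.P a → x ∈ S.P b → False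

/-- The weight of a path system: the ordered product `w(P₁)⋯w(P_k)`. -/
def PathSys.weight {R : Type u} {m n : ℕ} [Ring R] (D : QMData R m n)
    {white : Fin m → Fin n → Bool} {k : ℕ} {ι : Fin k → Fin m} {κ : Fin k → Fin n}
    (S : PathSys white ι κ) : R :=
  ((List.finRange k).map fun l => pathWeight D (S.P l)).prod

/-- The `q`-sign of a path system: `(-q) ^ ℓ(σ_P)`. -/
def PathSys.sgnq {R : Type u} {m n : ℕ} [Ring R] (D : QMData R m n)
    {white : Fin m → Fin n → Bool} {k : ℕ} {ι : Fin k → Fin m} {κ : Fin k → Fin n}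
    (S : PathSys white ι κ) : R :=
  (-(D.q : R)) ^ invCount S.σ

namespace CauchonPath

variable {m n : ℕ} {white : Fin m → Fin n → Bool} {l : List (CVertex m n)}

/-- Every vertex of a chain other than its last one is the tail of an edge inside the chain. -/
theorem exists_succ {α : Type*} {E : α → α → Prop} {l : List α} (hl : l.IsChain E) {w x : α}
    (hw : l.getLast? = some w) (hx : x ∈ l) (hxw : x ≠ w) : ∃ y ∈ l, E x y := by
  obtain ⟨s, t, rfl⟩ := List.append_of_mem hx
  cases t with
  | nil => simp_all
  | cons y t =>
    refine ⟨y, by simp, ?_⟩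
    have h := (List.isChain_append.1 hl).2.1
    exact (List.isChain_cons_cons.1 h).1

/-- Every vertex of a chain other than its first one is the head of an edge inside the chain. -/
theorem exists_pred {α : Type*} {E : α → α → Prop} {l : List α} (hl : l.IsChain E) {v x : α}
    (hv : l.head? = some v) (hx : x ∈ l) (hxv : x ≠ v) : ∃ y ∈ l, E y x := by
  obtain ⟨y, hy, hE⟩ := exists_succ (E := fun a b => E b a) (l := l.reverse)
    (List.isChain_reverse.2 hl) (by simpa using hv) (by simpa using hx) hxv
  exact ⟨y, by simpa using hy, hE⟩

/-- The grid points covered by the edges of a path, where squares are continued to the right of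
the diagram (along the edge out of `r_i`) and below it (along the edge into `c_j`). -/
inductive Cov (white : Fin m → Fin n → Bool) (l : List (CVertex m n)) : ℕ → ℕ → Prop
  | sq (i : Fin m) (j : Fin n) : .sq i j ∈ l → Cov white l i j
  | row (i : Fin m) (j : Fin n) (c : ℕ) : .row i ∈ l → .sq i j ∈ l →
      CEdge white (.row i) (.sq i j) → (j : ℕ) < c → Cov white l i c
  | horiz (i : Fin m) (k j : Fin n) (c : ℕ) : .sq i k ∈ l → .sq i j ∈ l →
      CEdge white (.sq i k) (.sq i j) → (j : ℕ) < c → c < k → Cov white l i c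
  | vert (i i' : Fin m) (j : Fin n) (r : ℕ) : .sq i j ∈ l → .sq i' j ∈ l →
      CEdge white (.sq i j) (.sq i' j) → (i : ℕ) < r → r < i' → Cov white l r j
  | col (i : Fin m) (j : Fin n) (r : ℕ) : .sq i j ∈ l → .col j ∈ l →
      CEdge white (.sq i j) (.col j) → (i : ℕ) < r → Cov white l r j

theorem Cov.forward {u : CVertex m n} {j₀ : Fin n} (hl : IsPathFrom white u (.col j₀) l)
    {r c : ℕ} (h : Cov white l r c) :
    (∃ c', c = c' + 1 ∧ Cov white l r c') ∨ Cov white l (r + 1) c := by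
  cases h with
  | sq i j hij =>
    obtain ⟨y, hy, hE⟩ := exists_succ hl.1 hl.2.2 hij (by simp)
    cases hE with
    | toCol _ _ h₁ h₂ => exact .inr (.col i j _ hij hy (.toCol i j h₁ h₂) (by omega))
    | horiz _ _ k hk h₁ h₂ h₃ =>
      refine .inl ⟨j - 1, by omega, ?_⟩
      rcases (show (k : ℕ) = j - 1 ∨ (k : ℕ) < j - 1 by omega) with e | e
      · exact e ▸ .sq i k hy
      · exact .horiz i j k _ hij hy (.horiz i j k hk h₁ h₂ h₃) e (by omega)
    | vert _ i' _ hi h₁ h₂ h₃ =>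
      right
      rcases (show (i' : ℕ) = i + 1 ∨ (i : ℕ) + 1 < i' by omega) with e | e
      · exact e ▸ .sq i' j hy
      · exact .vert i i' j _ hij hy (.vert i i' j hi h₁ h₂ h₃) (by omega) e
  | row i j c h₁ h₂ hE hj =>
    refine .inl ⟨c - 1, by omega, ?_⟩
    rcases (show (j : ℕ) = c - 1 ∨ (j : ℕ) < c - 1 by omega) with e | e
    · exact e ▸ .sq i j h₂
    · exact .row i j _ h₁ h₂ hE e
  | horiz i k j c h₁ h₂ hE hj hk =>
    refine .inl ⟨c - 1, by omega, ?_⟩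
    rcases (show (j : ℕ) = c - 1 ∨ (j : ℕ) < c - 1 by omega) with e | e
    · exact e ▸ .sq i j h₂
    · exact .horiz i k j _ h₁ h₂ hE e (by omega)
  | vert i i' j r h₁ h₂ hE hi hi' =>
    right
    rcases (show (i' : ℕ) = r + 1 ∨ r + 1 < i' by omega) with e | e
    · exact e ▸ .sq i' j h₂
    · exact .vert i i' j _ h₁ h₂ hE (by omega) e
  | col i j r h₁ h₂ hE hi => exact .inr (.col i j _ h₁ h₂ hE (by omega))

theorem Cov.backward {v : CVertex m n} {i₀ : Fin m} (hl : IsPathFrom white (.row i₀) v l)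
    {r c : ℕ} (h : Cov white l r c) :
    Cov white l r (c + 1) ∨ ∃ r', r = r' + 1 ∧ Cov white l r' c := by
  cases h with
  | sq i j hij =>
    obtain ⟨y, hy, hE⟩ := exists_pred hl.1 hl.2.1 hij (by simp)
    cases hE with
    | fromRow _ _ h₁ h₂ => exact .inl (.row i j _ hy hij (.fromRow i j h₁ h₂) (by omega))
    | horiz _ k _ hk h₁ h₂ h₃ =>
      left
      rcases (show (k : ℕ) = j + 1 ∨ (j : ℕ) + 1 < k by omega) with e | e
      · exact e ▸ .sq i k hy
      · exact .horiz i k j _ hy hij (.horiz i k j hk h₁ h₂ h₃) (by omega) e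
    | vert i' _ _ hi h₁ h₂ h₃ =>
      refine .inr ⟨i - 1, by omega, ?_⟩
      rcases (show (i' : ℕ) = i - 1 ∨ (i' : ℕ) < i - 1 by omega) with e | e
      · exact e ▸ .sq i' j hy
      · exact .vert i' i j _ hy hij (.vert i' i j hi h₁ h₂ h₃) e (by omega)
  | row i j c h₁ h₂ hE hj => exact .inl (.row i j _ h₁ h₂ hE (by omega))
  | horiz i k j c h₁ h₂ hE hj hk =>
    left
    rcases (show (k : ℕ) = c + 1 ∨ c + 1 < k by omega) with e | e
    · exact e ▸ .sq i k h₁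
    · exact .horiz i k j _ h₁ h₂ hE (by omega) e
  | vert i i' j r h₁ h₂ hE hi hi' =>
    refine .inr ⟨r - 1, by omega, ?_⟩
    rcases (show (i : ℕ) = r - 1 ∨ (i : ℕ) < r - 1 by omega) with e | e
    · exact e ▸ .sq i j h₁
    · exact .vert i i' j _ h₁ h₂ hE e (by omega)
  | col i j r h₁ h₂ hE hi =>
    refine .inr ⟨r - 1, by omega, ?_⟩
    rcases (show (i : ℕ) = r - 1 ∨ (i : ℕ) < r - 1 by omega) with e | e
    · exact e ▸ .sq i j h₁
    · exact .col i j _ h₁ h₂ hE e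

theorem eq_of_row_mem {v : CVertex m n} {i i₀ : Fin m}
    (hl : IsPathFrom white (.row i₀) v l) (h : .row i ∈ l) : i = i₀ := by
  by_contra hne
  obtain ⟨y, -, hE⟩ := exists_pred hl.1 hl.2.1 h (by simpa using hne)
  cases hE

theorem Cov.row_eq {v : CVertex m n} {i₀ : Fin m} (hl : IsPathFrom white (.row i₀) v l)
    {r c : ℕ} (h : Cov white l r c) (hc : n ≤ c) : r = i₀ := by
  cases h with
  | row i j c h₁ => rw [eq_of_row_mem hl h₁]
  | _ => omega

theorem cov_start {i₀ : Fin m} {j₀ : Fin n} (hl : IsPathFrom white (.row i₀) (.col j₀) l)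
    {c : ℕ} (hc : n ≤ c) : Cov white l i₀ c := by
  have hmem : CVertex.row i₀ ∈ l := List.mem_of_head? hl.2.1
  obtain ⟨y, hy, hE⟩ := exists_succ hl.1 hl.2.2 hmem (by simp)
  cases hE with
  | fromRow _ k h₁ h₂ => exact .row i₀ k c hmem hy (.fromRow i₀ k h₁ h₂) (by omega)

/-- A path covers a point on every diagonal `r - c = t - n`. -/
theorem exists_cov {i₀ : Fin m} {j₀ : Fin n} (hl : IsPathFrom white (.row i₀) (.col j₀) l)
    (t : ℕ) : ∃ r c, r + n = c + t ∧ Cov white l r c := by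
  induction t with
  | zero => exact ⟨i₀, i₀ + n, rfl, cov_start hl (by omega)⟩
  | succ t ih =>
    obtain ⟨r, c, e, h⟩ := ih
    rcases h.forward hl with ⟨c', rfl, hs⟩ | hs
    · exact ⟨r, c', by omega, hs⟩
    · exact ⟨r + 1, c, by omega, hs⟩

/-- A covered point is reached horizontally or vertically: the nearest white square weakly to its
left, or the one weakly above it, lies on the path. -/
theorem Cov.left_or_above {v : CVertex m n} {i₀ : Fin m}
    (hl : IsPathFrom white (.row i₀) v l) {r c : ℕ} (h : Cov white l r c) :
    (∃ i j, .sq i j ∈ l ∧ white i j = true ∧ r = i ∧ (j : ℕ) ≤ c ∧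
      ∀ j' : Fin n, j < j' → (j' : ℕ) ≤ c → white i j' = false) ∨
    (∃ i j, .sq i j ∈ l ∧ white i j = true ∧ c = j ∧ (i : ℕ) < r ∧
      ∀ i' : Fin m, i < i' → (i' : ℕ) ≤ r → white i' j = false) := by
  cases h with
  | sq i j hij =>
    have hw : white i j = true := by
      obtain ⟨y, -, hE⟩ := exists_pred hl.1 hl.2.1 hij (by simp)
      cases hE <;> assumption
    exact .inl ⟨i, j, hij, hw, rfl, le_rfl, fun j' _ _ => by omega⟩
  | row i j c h₁ h₂ hE hj =>
    cases hE with
    | fromRow _ _ hw hb => exact .inl ⟨i, j, h₂, hw, rfl, hj.le, fun j' h _ => hb j' h⟩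
  | horiz i k j c h₁ h₂ hE hj hk =>
    cases hE with
    | horiz _ _ _ _ _ hw hb =>
      exact .inl ⟨i, j, h₂, hw, rfl, hj.le, fun j' h h' => hb j' h (by omega)⟩
    | vert _ _ _ h => omega
  | vert i i' j r h₁ h₂ hE hi hi' =>
    cases hE with
    | horiz _ _ _ h => omega
    | vert _ _ _ _ hw _ hb =>
      exact .inr ⟨i, j, h₁, hw, rfl, hi, fun j' h h' => hb j' h (by omega)⟩
  | col i j r h₁ h₂ hE hi =>
    cases hE with
    | toCol _ _ hw hb => exact .inr ⟨i, j, h₁, hw, rfl, hi, fun p h _ => hb p h⟩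

/-- In a Cauchon diagram no horizontal edge crosses a vertical edge between squares. -/
theorem not_crossing (hC : IsCauchon white) {i₁ i₂ : Fin m} {j₁ j₂ : Fin n}
    (h₁ : white i₁ j₁ = true) (h₂ : white i₂ j₂ = true) (hj : j₁ ≤ j₂) (hi : i₂ < i₁)
    (hb : white i₁ j₂ = false) : False := by
  have hne : j₁ ≠ j₂ := by rintro rfl; simp [h₁] at hb
  rcases hC i₁ j₂ hb with h | h
  · simp [h i₂ hi] at h₂
  · simp [h j₁ (lt_of_le_of_ne hj hne)] at h₁

/-- Paths covering a common point share a vertex. -/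
theorem exists_common_of_cov (hC : IsCauchon white) {l' : List (CVertex m n)}
    {v v' : CVertex m n} {i₀ i₀' : Fin m}
    (hl : IsPathFrom white (.row i₀) v l) (hl' : IsPathFrom white (.row i₀') v' l')
    {r c : ℕ} (h : Cov white l r c) (h' : Cov white l' r c) : ∃ x, x ∈ l ∧ x ∈ l' := by
  rcases h.left_or_above hl with ⟨i, j, hm, hw, hr, hc, hb⟩ | ⟨i, j, hm, hw, hr, hc, hb⟩ <;>
  rcases h'.left_or_above hl' with ⟨i', j', hm', hw', hr', hc', hb'⟩ |
    ⟨i', j', hm', hw', hr', hc', hb'⟩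
  · obtain rfl : i = i' := by omega
    rcases lt_trichotomy j j' with e | rfl | e
    · simp [hb j' e hc'] at hw'
    · exact ⟨_, hm, hm'⟩
    · simp [hb' j e hc] at hw
  · exact (not_crossing hC hw hw' (by omega) (by omega) (hb' i (by omega) (by omega))).elim
  · exact (not_crossing hC hw' hw (by omega) (by omega) (hb i' (by omega) (by omega))).elim
  · obtain rfl : j = j' := by omega
    rcases lt_trichotomy i i' with e | rfl | e
    · simp [hb i' e hc'.le] at hw'
    · exact ⟨_, hm, hm'⟩
    · simp [hb' i e hc.le] at hw

/-- `l` lies strictly above `l'` on every diagonal. -/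
def Above (white : Fin m → Fin n → Bool) (l l' : List (CVertex m n)) : Prop :=
  ∀ t r c r' c', r + n = c + t → r' + n = c' + t → Cov white l r c → Cov white l' r' c' → r < r'

theorem above_of_disjoint (hC : IsCauchon white) {l' : List (CVertex m n)}
    {v v' : CVertex m n} {i₀ i₀' : Fin m}
    (hl : IsPathFrom white (.row i₀) v l) (hl' : IsPathFrom white (.row i₀') v' l')
    (hi : i₀ < i₀') (hd : ¬ ∃ x, x ∈ l ∧ x ∈ l') : Above white l l' := by
  intro t
  induction t with
  | zero =>
    intro r c r' c' e e' h h'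
    rw [h.row_eq hl (by omega), h'.row_eq hl' (by omega)]
    exact hi
  | succ t ih =>
    intro r c r' c' e e' h h'
    have hne : r ≠ r' := by
      rintro rfl
      obtain rfl : c = c' := by omega
      exact hd (exists_common_of_cov hC hl hl' h h')
    rcases h.backward hl with hp | ⟨p, rfl, hp⟩ <;>
    rcases h'.backward hl' with hp' | ⟨p', rfl, hp'⟩ <;>
    · have := ih _ _ _ _ (by omega) (by omega) hp hp'
      omega

theorem Above.trans {l₁ l₂ l₃ : List (CVertex m n)} {i₀ : Fin m} {j₀ : Fin n}
    (hl : IsPathFrom white (.row i₀) (.col j₀) l₂) (h : Above white l₁ l₂)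
    (h' : Above white l₂ l₃) : Above white l₁ l₃ := by
  intro t r c r' c' e e' hc hc'
  obtain ⟨p, q, e'', hp⟩ := exists_cov hl t
  exact (h t _ _ _ _ e e'' hc hp).trans (h' t _ _ _ _ e'' e' hp hc')

theorem exists_bottom_of_col_mem {v : CVertex m n} {i₀ : Fin m} {j : Fin n}
    (hl : IsPathFrom white (.row i₀) v l) (h : .col j ∈ l) :
    ∃ i, .sq i j ∈ l ∧ white i j = true ∧ ∀ i', i < i' → white i' j = false := by
  obtain ⟨y, hy, hE⟩ := exists_pred hl.1 hl.2.1 h (by simp)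
  cases hE with
  | toCol i _ h₁ h₂ => exact ⟨i, hy, h₁, h₂⟩

theorem Above.disjoint {l' : List (CVertex m n)} {v v' : CVertex m n} {i₀ i₀' : Fin m}
    (hl : IsPathFrom white (.row i₀) v l) (hl' : IsPathFrom white (.row i₀') v' l')
    (hi : i₀ ≠ i₀') (h : Above white l l') {x : CVertex m n} (hx : x ∈ l) (hx' : x ∈ l') :
    False := by
  have hsq : ∀ i j, .sq i j ∈ l → .sq i j ∈ l' → False := fun i j hm hm' =>
    lt_irrefl _ (h (i + n - j) i j i j (by omega) (by omega) (.sq i j hm) (.sq i j hm'))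
  cases x with
  | sq i j => exact hsq i j hx hx'
  | row i => exact hi ((eq_of_row_mem hl hx).symm.trans (eq_of_row_mem hl' hx'))
  | col j =>
    obtain ⟨i, hm, hw, hb⟩ := exists_bottom_of_col_mem hl hx
    obtain ⟨i', hm', hw', hb'⟩ := exists_bottom_of_col_mem hl' hx'
    rcases lt_trichotomy i i' with e | rfl | e
    · simp [hb i' e] at hw'
    · exact hsq i j hm hm'
    · simp [hb' i e] at hw

end CauchonPath

/-- a non-vertex-disjoint path system has two consecutive paths
sharing a vertex. -/
theorem consecutive_intersecting_paths {m n k : ℕ} (white : Fin m → Fin n → Bool)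
    (hC : IsCauchon white) (ι : Fin k → Fin m) (κ : Fin k → Fin n)
    (hι : StrictMono ι) (hκ : StrictMono κ)
    (S : PathSys white ι κ) (hnd : ¬ S.VertexDisjoint) :
    ∃ a b : Fin k, (b : ℕ) = (a : ℕ) + 1 ∧ ∃ x : CVertex m n, x ∈ S.P a ∧ x ∈ S.P b := by
  by_contra hcon
  have key : ∀ d : ℕ, ∀ a b : Fin k, (b : ℕ) = a + d + 1 →
      CauchonPath.Above white (S.P a) (S.P b) := by
    intro d
    induction d with
    | zero =>
      intro a b hab
      exact CauchonPath.above_of_disjoint hC (S.isPath a) (S.isPath b)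
        (hι (by omega)) fun hx => hcon ⟨a, b, hab, hx⟩
    | succ d ih =>
      intro a b hab
      let p : Fin k := ⟨a + d + 1, by omega⟩
      exact (ih a p rfl).trans (S.isPath p) <|
        CauchonPath.above_of_disjoint hC (S.isPath p) (S.isPath b)
          (hι (by simp only [p, Fin.lt_def]; omega)) fun hx => hcon ⟨p, b, hab, hx⟩
  refine hnd fun a b hab x hx hx' => ?_
  rcases lt_or_gt_of_ne hab with h | h
  · exact (key (b - a - 1) a b (by omega)).disjoint (S.isPath a) (S.isPath b)
      (hι.injective.ne hab) hx hx'
  · exact (key (a - b - 1) b a (by omega)).disjoint (S.isPath b) (S.isPath a)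
      (hι.injective.ne hab.symm) hx' hx
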